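/- arXiv:1901.01959 — 2 statements merged into one kernel-verified Lean document; each statement's English description precedes it below -/
import Mathlib

section
/- Let G be a connected simple graph with toughness τ(G) = t ≤ 1, and let S be a tough-set of G. Then every vertex of S is adjacent to vertices of at least two distinct connected components of G − S. -/
open SimpleGraph

variable {V : Type*} {W : Type*}

/-- A graph is `P₄`-free if it contains no induced subgraph isomorphic to the
path on four vertices. -/
def P4Free (G : SimpleGraph V) : Prop := IsEmpty (SimpleGraph.pathGraph 4 ↪g G)

/-- `R` is (the vertex set of) a connected component of `G - S`:
a maximal subset of `V(G) - S` inducing a connected subgraph. -/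
def IsCompOf (G : SimpleGraph V) (S R : Set V) : Prop :=
  R ⊆ Sᶜ ∧ (G.induce R).Connected ∧
    ∀ R' : Set V, R ⊆ R' → R' ⊆ Sᶜ → (G.induce R').Connected → R' = R

/-- The number of connected components of `G - S`. -/
noncomputable def numComp (G : SimpleGraph V) (S : Set V) : ℕ :=
  {R : Set V | IsCompOf G S R}.ncard

/-- `S` is a cutset of `G` : the graph `G - S` is disconnected. -/
def IsCutset (G : SimpleGraph V) (S : Set V) : Prop := 2 ≤ numComp G S

/-- `G` is `t`-tough: for every cutset `S`, `t * c(G - S) ≤ |S|`. -/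
def Tough (t : ℝ) (G : SimpleGraph V) : Prop :=
  ∀ S : Set V, IsCutset G S → t * (numComp G S : ℝ) ≤ (S.ncard : ℝ)

/-- `t` is the toughness of `G` : the largest `s` such that `G` is `s`-tough.
(For a complete graph no such largest `s` exists; the toughness is infinite.) -/
def IsToughness (G : SimpleGraph V) (t : ℝ) : Prop :=
  Tough t G ∧ ∀ s : ℝ, Tough s G → s ≤ t

/-- `S` is a tough-set of `G` (whose toughness is `t`): a cutset with
`|S| = t * c(G - S)`. -/
def ToughSet (G : SimpleGraph V) (t : ℝ) (S : Set V) : Prop :=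
  IsCutset G S ∧ (S.ncard : ℝ) = t * (numComp G S : ℝ)

/-- Vertex `u` is adjacent in `G` to some vertex of the set `R`. -/
def AdjToSet (G : SimpleGraph V) (u : V) (R : Set V) : Prop := ∃ v ∈ R, G.Adj u v

/-- `G` has a Hamiltonian cycle. -/
def HasHamCycle [DecidableEq V] (G : SimpleGraph V) : Prop :=
  ∃ (v : V) (w : G.Walk v v), w.IsHamiltonianCycle

/-- `G` has a spanning `k`-walk: a closed walk visiting every vertex at least once
and at most `k` times.  (In a nontrivial closed walk the base vertex occurs one
extra time in `Walk.support`, whence the correction term.) -/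
def HasSpanningKWalk [DecidableEq V] (G : SimpleGraph V) (k : ℕ) : Prop :=
  ∃ (v : V) (w : G.Walk v v), (∀ x : V, x ∈ w.support) ∧
    ∀ x : V, w.support.count x ≤ k + (if x = v then 1 else 0)

/-- The prism over `G`: the Cartesian (box) product `G □ K₂`. -/
def prism (G : SimpleGraph V) : SimpleGraph (V × Fin 2) :=
  G.boxProd (⊤ : SimpleGraph (Fin 2))

/-- The graph obtained from `G` by contracting the set `R` to a single vertex
(namely `Sum.inr ()`), which is adjacent to exactly those vertices outside `R`
having a neighbor in `R`. -/
def contractSet (G : SimpleGraph V) (R : Set V) : SimpleGraph (↥(Rᶜ) ⊕ Unit) :=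
  SimpleGraph.fromRel fun x y =>
    match x, y with
    | Sum.inl a, Sum.inl b => G.Adj ↑a ↑b
    | Sum.inl a, Sum.inr _ => ∃ r ∈ R, G.Adj ↑a r
    | _, _ => False

/-- `v` is a cutvertex of `H` : deleting `v` leaves a disconnected
(non-preconnected) graph. -/
def IsCutvertex (H : SimpleGraph W) (v : W) : Prop :=
  ¬ (H.induce ({v}ᶜ : Set W)).Preconnected

/-- `B` is a block of `H` : a maximal connected subgraph having no cutvertex of
its own. -/
def IsBlock (H : SimpleGraph W) (B : H.Subgraph) : Prop :=
  B.coe.Connected ∧ (∀ v, ¬ IsCutvertex B.coe v) ∧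
    ∀ B' : H.Subgraph, B ≤ B' → B'.coe.Connected →
      (∀ v, ¬ IsCutvertex B'.coe v) → B' = B

/-- `H` is a cycle of even length. -/
def IsEvenCycleGraph (H : SimpleGraph W) : Prop :=
  ∃ n : ℕ, Even n ∧ 3 ≤ n ∧ Nonempty (H ≃g SimpleGraph.cycleGraph n)

/-- `H` is a single edge. -/
def IsSingleEdgeGraph (H : SimpleGraph W) : Prop :=
  ∃ u v : W, u ≠ v ∧ H.Adj u v ∧ ∀ w : W, w = u ∨ w = v

/-- `H` is a simple block EP (SBEP) graph: a connected graph in which every block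
is an even cycle or a single edge, and every vertex lies in at most two blocks. -/
def IsSBEP (H : SimpleGraph W) : Prop :=
  H.Connected ∧
    (∀ B : H.Subgraph, IsBlock H B → IsEvenCycleGraph B.coe ∨ IsSingleEdgeGraph B.coe) ∧
    ∀ (v : W) (B₁ B₂ B₃ : H.Subgraph),
      IsBlock H B₁ ∧ v ∈ B₁.verts → IsBlock H B₂ ∧ v ∈ B₂.verts →
      IsBlock H B₃ ∧ v ∈ B₃.verts → B₁ = B₂ ∨ B₁ = B₃ ∨ B₂ = B₃

/-- `v` is a single-block vertex of `H` : it lies in exactly one block. -/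
def SingleBlockVertex (H : SimpleGraph W) (v : W) : Prop :=
  ∃! B : H.Subgraph, IsBlock H B ∧ v ∈ B.verts

/-- A connected vertex set avoiding `S` and closed under adjacency outside `S` is a component. -/
theorem IsCompOf.of_closed {V : Type*} {G : SimpleGraph V} {S R : Set V} (hRS : R ⊆ Sᶜ)
    (hR : (G.induce R).Connected) (hcl : ∀ v ∈ R, ∀ w, w ∉ S → G.Adj v w → w ∈ R) :
    IsCompOf G S R := by
  refine ⟨hRS, hR, fun R' hRR' hR'S hR' => (Set.Subset.antisymm hRR' ?_).symm⟩
  intro x hx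
  by_contra hxR
  obtain ⟨⟨r, hr⟩⟩ := hR.nonempty
  obtain ⟨p⟩ := hR'.preconnected ⟨r, hRR' hr⟩ ⟨x, hx⟩
  obtain ⟨d, -, hd₁, hd₂⟩ := p.exists_boundary_dart {y : R' | (y : V) ∈ R} hr hxR
  exact hd₂ (hcl _ hd₁ _ (hR'S d.snd.2) d.adj)

/-- A single vertex induces a connected graph. -/
theorem induce_singleton_connected {V : Type*} (G : SimpleGraph V) (u : V) :
    (G.induce ({u} : Set V)).Connected :=
  { preconnected := .of_subsingleton, nonempty := ⟨⟨u, rfl⟩⟩ }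

/-- Adding a neighbour to a connected vertex set keeps it connected. -/
theorem induce_insert_connected {V : Type*} {G : SimpleGraph V} {R : Set V} {u : V}
    (hR : (G.induce R).Connected) (hu : AdjToSet G u R) :
    (G.induce (insert u R)).Connected := by
  obtain ⟨v, hv, huv⟩ := hu
  rw [Set.insert_eq]
  exact connected_induce_union (induce_singleton_connected G u).preconnected hR.preconnected rfl hv huv

/-- A component contains every vertex outside `S` adjacent to it. -/
theorem IsCompOf.mem_of_adj {V : Type*} {G : SimpleGraph V} {S R : Set V}
    (h : IsCompOf G S R) {v w : V} (hv : v ∈ R) (hw : w ∉ S) (hvw : G.Adj v w) : w ∈ R := by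
  rw [← h.2.2 (insert w R) (Set.subset_insert w R) (Set.insert_subset hw h.1)
    (induce_insert_connected h.2.1 ⟨v, hv, hvw.symm⟩)]
  exact Set.mem_insert w R

/-- Every vertex outside `S` lies in a component of `G - S`. -/
theorem exists_isCompOf_mem {V : Type*} [Finite V] (G : SimpleGraph V) {S : Set V} {w : V}
    (hw : w ∉ S) : ∃ R, IsCompOf G S R ∧ w ∈ R := by
  obtain ⟨R, hwR, hR⟩ :=
    (Set.toFinite {R : Set V | R ⊆ Sᶜ ∧ (G.induce R).Connected}).exists_le_maximal
      (a := {w}) ⟨by simpa using hw, induce_singleton_connected G w⟩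
  exact ⟨R, ⟨hR.prop.1, hR.prop.2, fun R' h h₁ h₂ => (hR.eq_of_subset ⟨h₁, h₂⟩ h).symm⟩,
    hwR rfl⟩

/-- Putting back a vertex of `S` adjacent to at most one component of `G - S` does not
decrease the number of components. -/
theorem numComp_le_numComp_diff_singleton {V : Type*} [Finite V] {G : SimpleGraph V}
    {S : Set V} {u : V} (hu : u ∈ S)
    (h : ∀ R₁ R₂, IsCompOf G S R₁ → IsCompOf G S R₂ → AdjToSet G u R₁ → AdjToSet G u R₂ →
      R₁ = R₂) :
    numComp G S ≤ numComp G (S \ {u}) := by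
  classical
  have hout : ∀ {w}, w ∉ S \ {u} → w ≠ u → w ∉ S := fun hw hne hwS => hw ⟨hwS, hne⟩
  refine Set.ncard_le_ncard_of_injOn
    (fun R => if AdjToSet G u R then insert u R else R) ?_ ?_ (Set.toFinite _)
  · intro R hR
    have hRS : R ⊆ (S \ {u})ᶜ := fun x hx hxS => hR.1 hx hxS.1
    by_cases hadj : AdjToSet G u R
    · simp only [hadj, if_true]
      refine IsCompOf.of_closed (Set.insert_subset (fun hx => hx.2 rfl) hRS)
        (induce_insert_connected hR.2.1 hadj) ?_
      intro v hv w hw hvw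
      by_cases hwu : w = u
      · exact Or.inl hwu
      · right
        rcases hv with rfl | hv
        · obtain ⟨R₂, hR₂, hwR₂⟩ := exists_isCompOf_mem G (hout hw hwu)
          rw [h R R₂ hR hR₂ hadj ⟨w, hwR₂, hvw⟩]
          exact hwR₂
        · exact hR.mem_of_adj hv (hout hw hwu) hvw
    · simp only [hadj, if_false]
      refine IsCompOf.of_closed hRS hR.2.1 fun v hv w hw hvw => ?_
      have hwu : w ≠ u := by
        rintro rfl
        exact hadj ⟨v, hv, hvw.symm⟩
      exact hR.mem_of_adj hv (hout hw hwu) hvw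
  · intro R₁ h₁ R₂ h₂ heq
    have hu₁ : u ∉ R₁ := fun hx => h₁.1 hx hu
    have hu₂ : u ∉ R₂ := fun hx => h₂.1 hx hu
    have hdiff : ∀ R : Set V, u ∉ R →
        (if AdjToSet G u R then insert u R else R) \ {u} = R := by
      intro R hR
      split_ifs <;> simp [hR]
    rw [← hdiff R₁ hu₁, ← hdiff R₂ hu₂]
    exact congrArg (· \ {u}) heq

/-- If `τ(G) = t ≤ 1` and `S` is a tough-set of `G`, then every
vertex of `S` is adjacent to at least two components of `G - S`. -/
theorem stmt_14 {V : Type*} [Fintype V] (G : SimpleGraph V) (t : ℝ)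
    (hconn : G.Connected) (htough : IsToughness G t) (ht : t ≤ 1)
    (S : Set V) (hS : ToughSet G t S) :
    ∀ u ∈ S, ∃ R₁ R₂ : Set V, IsCompOf G S R₁ ∧ IsCompOf G S R₂ ∧ R₁ ≠ R₂ ∧
      AdjToSet G u R₁ ∧ AdjToSet G u R₂ := by
  intro u hu
  by_contra hno
  have hle : numComp G S ≤ numComp G (S \ {u}) := by
    refine numComp_le_numComp_diff_singleton hu fun R₁ R₂ h₁ h₂ a₁ a₂ => ?_
    by_contra hne
    exact hno ⟨R₁, R₂, h₁, h₂, hne, a₁, a₂⟩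
  obtain ⟨hcut, hcard⟩ := hS
  have hbound := htough.1 (S \ {u}) (le_trans hcut hle)
  have hlt : ((S \ {u}).ncard : ℝ) < S.ncard := by
    exact_mod_cast Set.ncard_sdiff_singleton_lt_of_mem hu
  have hpos : (0 : ℝ) < numComp G S := by
    exact_mod_cast lt_of_lt_of_le two_pos hcut
  have ht₀ : 0 ≤ t := by
    have hnonneg : 0 ≤ t * numComp G S := hcard ▸ Nat.cast_nonneg _
    exact nonneg_of_mul_nonneg_left hnonneg hpos
  have hmono : t * numComp G S ≤ t * numComp G (S \ {u}) :=
    mul_le_mul_of_nonneg_left (by exact_mod_cast hle) ht₀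
  linarith
end

section
/- Let G be a connected P4-free simple graph with toughness τ(G) = t ≤ 1, and let S be a tough-set of G. Let R be a connected component of G − S, and let G′ be the graph obtained from G by contracting R into a single vertex (identifying all vertices of R to one vertex, with the new vertex adjacent to exactly the vertices of G − V(R) having a neighbor in R). Then G′ is t-tough. -/
open SimpleGraph

variable {V : Type*} {W : Type*}

theorem mem_of_preconnected_of_closed {G : SimpleGraph V} {Q P : Set V}
    (hQ : (G.induce Q).Preconnected)
    (hP : ∀ x ∈ Q, x ∈ P → ∀ y ∈ Q, G.Adj x y → y ∈ P) {a b : V}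
    (ha : a ∈ Q) (haP : a ∈ P) (hb : b ∈ Q) : b ∈ P := by
  have walk_closed : ∀ (x y : Q) (_ : (G.induce Q).Walk x y), x.1 ∈ P → y.1 ∈ P := by
    intro x y w
    induction w with
    | nil => exact id
    | @cons u v w h p ih => exact fun hx => ih (hP _ u.2 hx _ v.2 h)
  obtain ⟨w⟩ := hQ ⟨a, ha⟩ ⟨b, hb⟩
  exact walk_closed _ _ w haP

theorem IsCompOf.nonempty {G : SimpleGraph V} {X Q : Set V} (hQ : IsCompOf G X Q) :
    Q.Nonempty :=
  Set.nonempty_coe_sort.1 hQ.2.1.nonempty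

theorem IsCompOf.closed {G : SimpleGraph V} {X Q : Set V} (hQ : IsCompOf G X Q) {q u : V}
    (hq : q ∈ Q) (hu : u ∉ X) (hqu : G.Adj q u) : u ∈ Q := by
  have hqX : q ∉ X := hQ.1 hq
  have key := hQ.2.2 (Q ∪ {q, u}) Set.subset_union_left
    (by rintro x (hx | rfl | rfl); exacts [hQ.1 hx, hqX, hu])
    (SimpleGraph.induce_union_connected hQ.2.1.preconnected
      (SimpleGraph.induce_pair_connected_of_adj hqu).preconnected ⟨q, hq, by simp⟩)
  rw [← key]
  simp

theorem IsCompOf.eq_of_mem {G : SimpleGraph V} {X Q Q' : Set V} (hQ : IsCompOf G X Q)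
    (hQ' : IsCompOf G X Q') {q : V} (hq : q ∈ Q) (hq' : q ∈ Q') : Q = Q' := by
  have hc := SimpleGraph.induce_union_connected hQ.2.1.preconnected hQ'.2.1.preconnected
    ⟨q, hq, hq'⟩
  have hsub : Q ∪ Q' ⊆ Xᶜ := Set.union_subset hQ.1 hQ'.1
  exact (hQ.2.2 _ Set.subset_union_left hsub hc).symm.trans
    (hQ'.2.2 _ Set.subset_union_right hsub hc)

theorem pairwiseDisjoint_isCompOf (G : SimpleGraph V) (X : Set V) :
    {Q | IsCompOf G X Q}.PairwiseDisjoint id := by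
  intro Q hQ Q' hQ' hne
  exact Set.disjoint_left.2 fun x hx hx' => hne (hQ.eq_of_mem hQ' hx hx')

theorem exists_isCompOf [Finite V] (G : SimpleGraph V) {X : Set V} {v : V} (hv : v ∉ X) :
    ∃ Q, IsCompOf G X Q ∧ v ∈ Q := by
  have hmem : ({v} : Set V) ∈ {Q : Set V | v ∈ Q ∧ Q ⊆ Xᶜ ∧ (G.induce Q).Connected} :=
    ⟨rfl, by simpa using hv, by
      have : Nonempty ({v} : Set V) := ⟨⟨v, rfl⟩⟩
      rw [SimpleGraph.induce_singleton_eq_top]; exact SimpleGraph.connected_top⟩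
  obtain ⟨Q, -, hQ, hmax⟩ := (Set.toFinite _).exists_le_maximal hmem
  exact ⟨Q, ⟨hQ.2.1, hQ.2.2, fun R' h1 h2 h3 => (hmax ⟨h1 hQ.1, h2, h3⟩ h1).antisymm h1⟩, hQ.1⟩

theorem ncard_le_numComp [Finite V] {G : SimpleGraph V} {X : Set V} {F : Set (Set V)}
    (hne : ∀ Q ∈ F, Q.Nonempty) (hsub : ∀ Q ∈ F, Q ⊆ Xᶜ)
    (hcl : ∀ Q ∈ F, ∀ q ∈ Q, ∀ u, u ∉ X → G.Adj q u → u ∈ Q)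
    (hdisj : F.PairwiseDisjoint id) : F.ncard ≤ numComp G X := by
  have hex : ∀ Q, ∃ C, Q ∈ F → IsCompOf G X C ∧ C ⊆ Q := by
    intro Q
    by_cases hQ : Q ∈ F
    · obtain ⟨v, hv⟩ := hne Q hQ
      obtain ⟨C, hC, hvC⟩ := exists_isCompOf G (hsub Q hQ hv)
      exact ⟨C, fun _ => ⟨hC, fun b hb => mem_of_preconnected_of_closed hC.2.1.preconnected
        (fun x _ hx y hy hxy => hcl Q hQ x hx y (hC.1 hy) hxy) hvC hv hb⟩⟩
    · exact ⟨∅, fun h => absurd h hQ⟩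
  choose f hf using hex
  refine Set.ncard_le_ncard_of_injOn f (fun Q hQ => (hf Q hQ).1) ?_ (Set.toFinite _)
  intro Q hQ Q' hQ' h
  obtain ⟨x, hx⟩ := (hf Q hQ).1.nonempty
  exact hdisj.elim_set hQ hQ' x ((hf Q hQ).2 hx) ((hf Q' hQ').2 (h ▸ hx))

theorem ncard_le_of_pairwiseDisjoint_of_inter_nonempty [Finite V] {F : Set (Set V)} {A : Set V}
    (hdisj : F.PairwiseDisjoint id) (hA : ∀ Q ∈ F, (Q ∩ A).Nonempty) : F.ncard ≤ A.ncard := by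
  rcases F.eq_empty_or_nonempty with rfl | ⟨Q₀, hQ₀⟩
  · simp
  have : Nonempty V := ⟨(hA Q₀ hQ₀).some⟩
  choose! f hf using hA
  refine Set.ncard_le_ncard_of_injOn f (fun Q hQ => (hf Q hQ).2) ?_ (Set.toFinite _)
  intro Q hQ Q' hQ' h
  exact hdisj.elim_set hQ hQ' _ (hf Q hQ).1 (h ▸ (hf Q' hQ').1)

/-- Putting back the vertices of `X \ Y` only merges the components of `G - X` which they touch. -/
theorem numComp_add_one_le [Finite V] (G : SimpleGraph V) {X Y : Set V} (hYX : Y ⊆ X)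
    (hne : (X \ Y).Nonempty) :
    numComp G X + 1 ≤
      numComp G Y + {Q | IsCompOf G X Q ∧ ∃ q ∈ Q, AdjToSet G q (X \ Y)}.ncard := by
  set M := {Q | IsCompOf G X Q ∧ ∃ q ∈ Q, AdjToSet G q (X \ Y)} with hM
  set N := {Q | IsCompOf G X Q} \ M with hN
  have hsplit : N.ncard + M.ncard = numComp G X :=
    Set.ncard_sdiff_add_ncard_of_subset (fun Q hQ => hQ.1)
  have hNX : ∀ Q ∈ N, IsCompOf G X Q := fun Q hQ => hQ.1
  have hNcl : ∀ Q ∈ N, ∀ q ∈ Q, ∀ u, u ∉ Y → G.Adj q u → u ∈ Q := by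
    intro Q hQ q hq u hu hqu
    by_cases hX : u ∈ X
    · exact absurd ⟨hQ.1, q, hq, u, ⟨hX, hu⟩, hqu⟩ hQ.2
    · exact hQ.1.closed hq hX hqu
  obtain ⟨z, hzX, hzY⟩ := hne
  have hz : z ∈ Yᶜ \ ⋃₀ N := ⟨hzY, fun ⟨Q, hQ, hzQ⟩ => (hNX Q hQ).1 hzQ hzX⟩
  have hnot : (Yᶜ \ ⋃₀ N) ∉ N := fun h => (hNX _ h).1 hz hzX
  have hle : (insert (Yᶜ \ ⋃₀ N) N).ncard ≤ numComp G Y := by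
    refine ncard_le_numComp ?_ ?_ ?_ ?_
    · rintro Q (rfl | hQ)
      exacts [⟨z, hz⟩, (hNX Q hQ).nonempty]
    · rintro Q (rfl | hQ)
      exacts [Set.sdiff_subset, (hNX Q hQ).1.trans (Set.compl_subset_compl.2 hYX)]
    · rintro Q (rfl | hQ) q hq u hu hqu
      · refine ⟨hu, fun ⟨Q, hQ, huQ⟩ => hq.2 ⟨Q, hQ, ?_⟩⟩
        exact hNcl Q hQ u huQ q hq.1 hqu.symm
      · exact hNcl Q hQ q hq u hu hqu
    · refine Set.PairwiseDisjoint.insert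
        ((pairwiseDisjoint_isCompOf G X).subset Set.sdiff_subset) ?_
      intro Q hQ _
      exact Set.disjoint_left.2 fun x hx hxQ => hx.2 ⟨Q, hQ, hxQ⟩
  rw [Set.ncard_insert_of_notMem hnot (Set.toFinite _)] at hle
  omega

theorem P4Free.adj_of_path {G : SimpleGraph V} (h : P4Free G) {a b c d : V} (hab : G.Adj a b)
    (hbc : G.Adj b c) (hcd : G.Adj c d) (hac : ¬ G.Adj a c) (hbd : ¬ G.Adj b d) :
    G.Adj a d := by
  by_contra had
  have nac : a ≠ c := by rintro rfl; exact had hcd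
  have nbd : b ≠ d := by rintro rfl; exact had hab
  have nad : a ≠ d := by rintro rfl; exact hac hcd.symm
  have hinj : Function.Injective ![a, b, c, d] := by
    intro i j
    fin_cases i <;> fin_cases j <;>
      simp [hab.ne, hab.ne', hbc.ne, hbc.ne', hcd.ne, hcd.ne', nac, nac.symm, nbd, nbd.symm,
        nad, nad.symm]
  refine h.false ⟨⟨![a, b, c, d], hinj⟩, ?_⟩
  intro i j
  rw [SimpleGraph.pathGraph_adj]
  fin_cases i <;> fin_cases j <;>
    simp [hab, hab.symm, hbc, hbc.symm, hcd, hcd.symm, hac, hbd, had, G.adj_comm c a,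
      G.adj_comm d b, G.adj_comm d a]

/-- In a `P₄`-free graph a vertex touching two components of `G - X` is adjacent to all of each. -/
theorem P4Free.adj_of_isCompOf {G : SimpleGraph V} (h : P4Free G) {X Q Q' : Set V}
    (hQ : IsCompOf G X Q) (hQ' : IsCompOf G X Q') (hne : Q ≠ Q') {s : V}
    (hs : AdjToSet G s Q) (hs' : AdjToSet G s Q') {q : V} (hq : q ∈ Q) : G.Adj s q := by
  obtain ⟨a, ha, hsa⟩ := hs
  obtain ⟨b, hb, hsb⟩ := hs'
  have hno : ∀ x ∈ Q, ¬ G.Adj b x := fun x hx hbx =>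
    hne (hQ.eq_of_mem hQ' hx (hQ'.closed hb (hQ.1 hx) hbx))
  refine mem_of_preconnected_of_closed (P := {x | G.Adj s x}) hQ.2.1.preconnected ?_ ha hsa hq
  intro x hx hsx y hy hxy
  by_contra hsy
  exact hno y hy (h.adj_of_path hsb.symm hsx hxy (hno x hx) hsy)

theorem ToughSet.nonneg {G : SimpleGraph V} {t : ℝ} {S : Set V} (hS : ToughSet G t S) :
    0 ≤ t := by
  by_contra hneg
  have hc : (2 : ℝ) ≤ numComp G S := by exact_mod_cast hS.1
  have : (0 : ℝ) ≤ S.ncard := by positivity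
  nlinarith [hS.2]

theorem ToughSet.ncard_le_touched [Finite V] {G : SimpleGraph V} {t : ℝ} {S A : Set V}
    (hG : Tough t G) (ht : t ≤ 1) (hS : ToughSet G t S) (hA : A ⊆ S) (hne : A.Nonempty) :
    A.ncard ≤ {Q | IsCompOf G S Q ∧ ∃ q ∈ Q, AdjToSet G q A}.ncard := by
  have h := numComp_add_one_le G (Set.sdiff_subset : S \ A ⊆ S)
    (by rwa [Set.sdiff_sdiff_cancel_left hA])
  rw [Set.sdiff_sdiff_cancel_left hA] at h
  set k := {Q | IsCompOf G S Q ∧ ∃ q ∈ Q, AdjToSet G q A}.ncard with hk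
  have hkc : k ≤ numComp G S := Set.ncard_le_ncard (fun Q hQ => hQ.1) (Set.toFinite _)
  have hcard : (S \ A).ncard + A.ncard = S.ncard := Set.ncard_sdiff_add_ncard_of_subset hA
  have ht0 : 0 ≤ t := hS.nonneg
  obtain ⟨-, hSt⟩ := hS
  have hcard' : ((S \ A).ncard : ℝ) + A.ncard = S.ncard := by exact_mod_cast hcard
  have h' : (numComp G S : ℝ) + 1 ≤ numComp G (S \ A) + k := by exact_mod_cast h
  have hk0 : (0 : ℝ) ≤ k := by positivity
  suffices (A.ncard : ℝ) ≤ k by exact_mod_cast this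
  by_cases hd : 2 ≤ numComp G (S \ A)
  · have := hG _ hd
    nlinarith
  · have hkeq : k = numComp G S := by omega
    have : (0 : ℝ) ≤ (S \ A).ncard := by positivity
    rw [← hkeq] at hSt
    nlinarith

theorem Tough.mul_numComp_union_le [Finite V] {G : SimpleGraph V} {t : ℝ} (hP4 : P4Free G)
    (hG : Tough t G) (ht : t ≤ 1) {S R T : Set V} (hS : ToughSet G t S) (hR : IsCompOf G S R)
    (hTR : Disjoint T R) (hcut : IsCutset G (T ∪ R)) :
    t * (numComp G (T ∪ R) : ℝ) ≤ T.ncard + 1 := by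
  have ht0 : 0 ≤ t := hS.nonneg
  have hcut' : 2 ≤ numComp G (T ∪ R) := hcut
  have hXT : (T ∪ R) \ T = R := by rw [Set.union_sdiff_left]; exact hTR.symm.sdiff_eq_left
  have hmerge := numComp_add_one_le G (Set.subset_union_left : T ⊆ T ∪ R)
    (by rw [hXT]; exact hR.nonempty)
  rw [hXT] at hmerge
  set M := {Q | IsCompOf G (T ∪ R) Q ∧ ∃ q ∈ Q, AdjToSet G q R} with hM
  by_cases hm : M.ncard ≤ 1
  · have h1 : numComp G (T ∪ R) ≤ numComp G T := by omega
    have h2 := hG T (hcut'.trans h1)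
    have h3 : (numComp G (T ∪ R) : ℝ) ≤ numComp G T := by exact_mod_cast h1
    nlinarith
  -- `A` is the set of neighbours of `R` outside `T`.
  set A := {a | a ∉ T ∪ R ∧ AdjToSet G a R} with hA
  have hAS : A ⊆ S := by
    rintro a ⟨haX, r, hr, har⟩
    by_contra haS
    exact haX (Or.inr (hR.closed hr haS har.symm))
  have hMA : M.ncard ≤ A.ncard := by
    refine ncard_le_of_pairwiseDisjoint_of_inter_nonempty
      ((pairwiseDisjoint_isCompOf G (T ∪ R)).subset fun Q hQ => hQ.1) ?_
    rintro Q ⟨hQ, q, hq, hqR⟩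
    exact ⟨q, hq, hQ.1 hq, hqR⟩
  have hAne : A.Nonempty := Set.nonempty_of_ncard_ne_zero (by omega)
  set K := {Q | IsCompOf G S Q ∧ ∃ q ∈ Q, AdjToSet G q A} with hK
  have hAK : A.ncard ≤ K.ncard := hS.ncard_le_touched hG ht hAS hAne
  have hRK : R ∈ K := by
    obtain ⟨a, ha⟩ := hAne
    obtain ⟨r, hr, har⟩ := ha.2
    exact ⟨hR, r, hr, a, ha, har.symm⟩
  have hother : ∀ a ∈ A, ∃ b ∈ A, ∀ Q, IsCompOf G (T ∪ R) Q → a ∈ Q → b ∉ Q := by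
    intro a ha
    obtain ⟨C, hC, haC⟩ := exists_isCompOf G ha.1
    obtain ⟨D, hD, hDC⟩ := Set.exists_ne_of_one_lt_ncard (not_le.1 hm) C
    obtain ⟨hDX, b, hb, hbR⟩ := hD
    refine ⟨b, ⟨hDX.1 hb, hbR⟩, fun Q hQ haQ hbQ => hDC ?_⟩
    rw [hDX.eq_of_mem hQ hb hbQ, hQ.eq_of_mem hC haQ haC]
  have hcompl : ∀ Q, IsCompOf G S Q → Q ≠ R → ∀ a ∈ A, AdjToSet G a Q →
      (∀ q ∈ Q, G.Adj a q) ∧ ∀ r ∈ R, G.Adj a r := fun Q hQ hne a ha haQ =>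
    ⟨fun q hq => hP4.adj_of_isCompOf hQ hR hne haQ ha.2 hq,
      fun r hr => hP4.adj_of_isCompOf hR hQ hne.symm ha.2 haQ hr⟩
  have hnadj : ∀ Q, IsCompOf G S Q → Q ≠ R → ∀ q ∈ Q, ∀ r ∈ R, ¬ G.Adj r q :=
    fun Q hQ hne q hq r hr hrq => hne (hQ.eq_of_mem hR hq (hR.closed hr (hQ.1 hq) hrq))
  have hKT : ∀ Q ∈ K \ {R}, Q ⊆ T := by
    rintro Q ⟨⟨hQ, q, hq, a, ha, hqa⟩, hne⟩ x hx
    replace hne : Q ≠ R := hne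
    obtain ⟨b, hb, hsep⟩ := hother a ha
    obtain ⟨C, hC, haC⟩ := exists_isCompOf G ha.1
    obtain ⟨haQ, haR⟩ := hcompl Q hQ hne a ha ⟨q, hq, hqa.symm⟩
    have hba : ¬ G.Adj b a := fun h => hsep C hC haC (hC.closed haC hb.1 h.symm)
    have hbq : G.Adj b q := by
      obtain ⟨r, hr, hbr⟩ := hb.2
      exact hP4.adj_of_path hbr (haR r hr).symm hqa.symm hba (hnadj Q hQ hne q hq r hr)
    obtain ⟨hbQ, -⟩ := hcompl Q hQ hne b hb ⟨q, hq, hbq⟩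
    by_contra hxT
    have hxR : x ∉ R := fun h => hne (hQ.eq_of_mem hR hx h)
    have hxX : x ∉ T ∪ R := fun h => h.elim hxT hxR
    exact hsep C hC haC (hC.closed (hC.closed haC hxX (haQ x hx)) hb.1 (hbQ x hx).symm)
  set U := ⋃₀ (K \ {R}) with hU
  have hUT : U ⊆ T := Set.sUnion_subset hKT
  have hKU : (K \ {R}).ncard ≤ U.ncard := by
    refine ncard_le_of_pairwiseDisjoint_of_inter_nonempty
      ((pairwiseDisjoint_isCompOf G S).subset fun Q hQ => hQ.1.1) fun Q hQ => ?_
    obtain ⟨x, hx⟩ := hQ.1.1.nonempty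
    exact ⟨x, hx, Q, hQ, hx⟩
  have hKcard : (K \ {R}).ncard + 1 = K.ncard :=
    Set.ncard_sdiff_singleton_add_one hRK (Set.toFinite _)
  have hTU : (T \ U).ncard + U.ncard = T.ncard := Set.ncard_sdiff_add_ncard_of_subset hUT
  have hmerge' := numComp_add_one_le G
    (Set.sdiff_subset.trans Set.subset_union_left : T \ U ⊆ T ∪ R)
    (by
      obtain ⟨r, hr⟩ := hR.nonempty
      exact ⟨r, Or.inr hr, fun h => hTR.le_bot ⟨h.1, hr⟩⟩)
  have htouch : {Q | IsCompOf G (T ∪ R) Q ∧ ∃ q ∈ Q, AdjToSet G q ((T ∪ R) \ (T \ U))} ⊆ M := by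
    rintro P ⟨hP, s, hs, z, ⟨hzX, hzTU⟩, hsz⟩
    by_cases hzR : z ∈ R
    · exact ⟨hP, s, hs, z, hzR, hsz⟩
    have hzU : z ∈ U := by
      by_contra hzU
      exact hzTU ⟨hzX.resolve_right hzR, hzU⟩
    obtain ⟨Q, ⟨⟨hQ, q, hq, a, ha, hqa⟩, hne⟩, hzQ⟩ := hzU
    replace hne : Q ≠ R := hne
    obtain ⟨haQ, haR⟩ := hcompl Q hQ hne a ha ⟨q, hq, hqa.symm⟩
    obtain ⟨r, hr⟩ := hR.nonempty
    by_cases hsa : G.Adj a s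
    · exact ⟨hP, a, hP.closed hs ha.1 hsa.symm, r, hr, haR r hr⟩
    · exact ⟨hP, s, hs, r, hr, (hP4.adj_of_path (haR r hr).symm (haQ z hzQ) hsz.symm
        (hnadj Q hQ hne z hzQ r hr) hsa).symm⟩
  have hle := Set.ncard_le_ncard htouch (Set.toFinite _)
  have hmT : M.ncard ≤ U.ncard + 1 := by omega
  have hcomp : numComp G (T ∪ R) + 1 ≤ numComp G (T \ U) + M.ncard := by omega
  have hmT' : (M.ncard : ℝ) ≤ U.ncard + 1 := by exact_mod_cast hmT
  have hm1 : (1 : ℝ) ≤ M.ncard := by exact_mod_cast (not_le.1 hm).le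
  have hTU' : ((T \ U).ncard : ℝ) + U.ncard = T.ncard := by exact_mod_cast hTU
  by_cases hd : 2 ≤ numComp G (T \ U)
  · have h1 := hG _ hd
    have hcomp' : (numComp G (T ∪ R) : ℝ) + 1 ≤ numComp G (T \ U) + M.ncard := by
      exact_mod_cast hcomp
    nlinarith
  · have h1 : numComp G (T ∪ R) ≤ T.ncard + 1 := by omega
    have h1' : (numComp G (T ∪ R) : ℝ) ≤ T.ncard + 1 := by exact_mod_cast h1
    nlinarith [(Nat.cast_nonneg (numComp G (T ∪ R)) : (0 : ℝ) ≤ _)]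

open Classical in
/-- The projection of `V` onto the vertices of `contractSet G R`. -/
noncomputable def contractProj (R : Set V) (v : V) : ↥(Rᶜ) ⊕ Unit :=
  if h : v ∈ R then Sum.inr () else Sum.inl ⟨v, h⟩

theorem contractProj_of_mem {R : Set V} {v : V} (h : v ∈ R) :
    contractProj R v = Sum.inr () := dif_pos h

theorem contractProj_of_notMem {R : Set V} {v : V} (h : v ∉ R) :
    contractProj R v = Sum.inl ⟨v, h⟩ := dif_neg h

theorem contractProj_surjective {R : Set V} (hR : R.Nonempty) :
    Function.Surjective (contractProj R) := by
  rintro (⟨v, hv⟩ | ⟨⟩)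
  · exact ⟨v, contractProj_of_notMem hv⟩
  · obtain ⟨r, hr⟩ := hR
    exact ⟨r, contractProj_of_mem hr⟩

theorem contractSet_adj_of_adj {G : SimpleGraph V} {R : Set V} {u v : V} (h : G.Adj u v)
    (hne : contractProj R u ≠ contractProj R v) :
    (contractSet G R).Adj (contractProj R u) (contractProj R v) := by
  refine (SimpleGraph.fromRel_adj _ _ _).2 ⟨hne, ?_⟩
  by_cases hu : u ∈ R <;> by_cases hv : v ∈ R
  · exact absurd ((contractProj_of_mem hu).trans (contractProj_of_mem hv).symm) hne
  · rw [contractProj_of_mem hu, contractProj_of_notMem hv]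
    exact Or.inr ⟨u, hu, h.symm⟩
  · rw [contractProj_of_notMem hu, contractProj_of_mem hv]
    exact Or.inl ⟨v, hv, h⟩
  · rw [contractProj_of_notMem hu, contractProj_of_notMem hv]
    exact Or.inl h

theorem numComp_contractSet_le [Finite V] (G : SimpleGraph V) {R : Set V} (hR : R.Nonempty)
    (T : Set (↥(Rᶜ) ⊕ Unit)) :
    numComp (contractSet G R) T ≤ numComp G (contractProj R ⁻¹' T) := by
  have hsurj := contractProj_surjective hR
  rw [numComp, ← Set.ncard_image_of_injective _ hsurj.preimage_injective]
  refine ncard_le_numComp ?_ ?_ ?_ ?_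
  · rintro _ ⟨Q, hQ, rfl⟩
    exact hQ.nonempty.preimage hsurj
  · rintro _ ⟨Q, hQ, rfl⟩ x hx
    exact hQ.1 hx
  · rintro _ ⟨Q, hQ, rfl⟩ q hq u hu hqu
    by_cases h : contractProj R q = contractProj R u
    · rw [Set.mem_preimage, ← h]
      exact hq
    · exact hQ.closed hq hu (contractSet_adj_of_adj hqu h)
  · rintro _ ⟨Q, hQ, rfl⟩ _ ⟨Q', hQ', rfl⟩ hne
    refine Disjoint.preimage _ (pairwiseDisjoint_isCompOf _ T hQ hQ' ?_)
    rintro rfl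
    exact hne rfl

/-- If `G` is a connected `P₄`-free graph with `τ(G) = t ≤ 1`, `S`
is a tough-set of `G` and `R` is a component of `G - S`, then contracting `R` to a
single vertex yields a `t`-tough graph. -/
theorem stmt_16 {V : Type*} [Fintype V] (G : SimpleGraph V) (t : ℝ)
    (hconn : G.Connected) (hP4 : P4Free G) (htough : IsToughness G t) (ht : t ≤ 1)
    (S : Set V) (hS : ToughSet G t S) (R : Set V) (hR : IsCompOf G S R) :
    Tough t (contractSet G R) := by

  have hle := numComp_contractSet_le G hR.nonempty
  have ht0 : 0 ≤ t := hS.nonneg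
  intro T hT
  have hT' : IsCutset G (contractProj R ⁻¹' T) := le_trans hT (hle T)
  refine (mul_le_mul_of_nonneg_left (Nat.cast_le.2 (hle T)) ht0).trans ?_
  set T₀ : Set V := (fun a : ↥(Rᶜ) => (a : V)) '' (Sum.inl ⁻¹' T) with hT₀
  have hmem : ∀ v, v ∉ R → (contractProj R v ∈ T ↔ v ∈ T₀) := by
    intro v hv
    rw [contractProj_of_notMem hv]
    constructor
    · exact fun h => ⟨⟨v, hv⟩, h, rfl⟩
    · rintro ⟨a, ha, rfl⟩
      exact ha
  have hdisj : Disjoint T₀ R := by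
    rw [Set.disjoint_left]
    rintro _ ⟨a, -, rfl⟩
    exact a.2
  have hcard : T₀.ncard = (Sum.inl '' (Sum.inl ⁻¹' T) : Set (↥(Rᶜ) ⊕ Unit)).ncard := by
    rw [Set.ncard_image_of_injective _ Subtype.val_injective,
      Set.ncard_image_of_injective _ Sum.inl_injective]
  by_cases hr : Sum.inr () ∈ T
  · have hpre : contractProj R ⁻¹' T = T₀ ∪ R := by
      ext v
      by_cases hv : v ∈ R
      · simp [hv, contractProj_of_mem hv, hr]
      · simp [hv, hmem v hv]
    have hTcard : T.ncard = T₀.ncard + 1 := by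
      rw [hcard, ← Set.ncard_insert_of_notMem (a := Sum.inr ()) (by simp) (Set.toFinite _)]
      congr 1
      ext (a | ⟨⟩) <;> simp [hr]
    rw [hpre] at hT' ⊢
    rw [hTcard, Nat.cast_add_one]
    exact htough.1.mul_numComp_union_le hP4 ht hS hR hdisj hT'
  · have hpre : contractProj R ⁻¹' T = T₀ := by
      ext v
      by_cases hv : v ∈ R
      · simp [contractProj_of_mem hv, hr, Set.disjoint_right.1 hdisj hv]
      · simp [hmem v hv]
    have hTcard : T.ncard = T₀.ncard := by
      rw [hcard]
      congr 1
      ext (a | ⟨⟩) <;> simp [hr]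
    rw [hTcard, ← hpre]
    exact htough.1 _ hT'
end
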